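/- arXiv:1511.02199 — 2 statements merged into one kernel-verified Lean document; each statement's English description precedes it below -/
import Mathlib

section
/- (Poisson-logarithmic bivariate PMF, compound Poisson side.) For every r > 0, p ∈ (0,1), and n, l ∈ ℕ, the joint PMF of l ∼ Pois(−r ln(1−p)) and n = Σ_{t=1}^l u_t with u_t i.i.d. Log(p) is Pois(−r ln(1−p))(l) · Log(p)^{*l}(n) = |s(n,l)| · r^l · p^n · (1−p)^r / n!. -/
open MeasureTheory

/-- The Poisson PMF: `Pois(λ)(n) = λ^n e^{-λ} / n!`. -/
noncomputable def poisPMF (lam : ℝ) (n : ℕ) : ℝ :=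
  lam ^ n * Real.exp (-lam) / n.factorial

/-- The gamma density with shape `a > 0` and rate `c > 0`:
`gammaPDF(a,c)(θ) = c^a / Γ(a) * θ^(a-1) * e^{-cθ}` for `θ > 0`, and `0` for `θ ≤ 0`. -/
noncomputable def gammaPDF (a c θ : ℝ) : ℝ :=
  if 0 < θ then c ^ a / Real.Gamma a * θ ^ (a - 1) * Real.exp (-(c * θ)) else 0

/-- The negative binomial PMF: `NB(r,p)(n) = Γ(n+r)/(n! Γ(r)) * p^n (1-p)^r`. -/
noncomputable def nbPMF (r p : ℝ) (n : ℕ) : ℝ :=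
  Real.Gamma (n + r) / (n.factorial * Real.Gamma r) * p ^ n * (1 - p) ^ r

/-- The unsigned Stirling number of the first kind `|s(n,l)|`: the coefficient of `X^l`
in the ascending factorial polynomial `X (X+1) ⋯ (X+n-1)`. -/
noncomputable def stirling1 (n l : ℕ) : ℕ :=
  (ascPochhammer ℕ n).coeff l

/-- The PMF of the Chinese restaurant table distribution `CRT(n,r)`: the distribution of
`l = Σ_{i=1}^n b_i` with independent `b_i ∼ Bernoulli(r/(r+i-1))`, defined by the
convolution recursion over `n`. -/
noncomputable def crtPMF (r : ℝ) : ℕ → ℕ → ℝ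
  | 0, l => if l = 0 then 1 else 0
  | n + 1, l =>
      r / (r + n) * (if l = 0 then 0 else crtPMF r n (l - 1))
        + (1 - r / (r + n)) * crtPMF r n l

/-- The logarithmic distribution PMF: `Log(p)(u) = p^u / (-ln(1-p) u)` for `u ≥ 1`, else `0`. -/
noncomputable def logPMF (p : ℝ) (u : ℕ) : ℝ :=
  if u = 0 then 0 else p ^ u / (-Real.log (1 - p) * u)

/-- The `l`-fold convolution `Log(p)^{*l}` of the logarithmic distribution, with
`Log(p)^{*0} = δ_0`. -/
noncomputable def logConv (p : ℝ) : ℕ → ℕ → ℝ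
  | 0, n => if n = 0 then 1 else 0
  | l + 1, n => ∑ u ∈ Finset.range (n + 1), logPMF p u * logConv p l (n - u)

/-- The power series `∑ u ≥ 1, X ^ u / u`, the expansion of `-log (1 - X)`. -/
noncomputable def negLogOneSub : PowerSeries ℝ :=
  PowerSeries.mk fun u => (u : ℝ)⁻¹

lemma one_sub_X_mul_derivative_negLogOneSub :
    (1 - PowerSeries.X) * PowerSeries.derivative ℝ negLogOneSub = 1 := by
  have h : PowerSeries.derivative ℝ negLogOneSub = PowerSeries.mk 1 := by
    ext n
    have hn : (n : ℝ) + 1 ≠ 0 := by positivity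
    simp [negLogOneSub, PowerSeries.coeff_derivative, hn]
  rw [h, mul_comm, PowerSeries.mk_one_mul_one_sub_eq_one]

lemma coeff_negLogOneSub_pow_succ (n l : ℕ) :
    (n + 1 : ℝ) * PowerSeries.coeff (n + 1) (negLogOneSub ^ (l + 1)) =
      n * PowerSeries.coeff n (negLogOneSub ^ (l + 1))
        + (l + 1) * PowerSeries.coeff n (negLogOneSub ^ l) := by
  have h : PowerSeries.derivative ℝ (negLogOneSub ^ (l + 1)) =
      PowerSeries.derivative ℝ (negLogOneSub ^ (l + 1)) * PowerSeries.X
        + ((l + 1 : ℕ) : ℝ) • negLogOneSub ^ l := by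
    rw [Derivation.leibniz_pow, Nat.add_sub_cancel, Nat.cast_smul_eq_nsmul]
    simp only [smul_eq_mul, nsmul_eq_mul]
    linear_combination (((l + 1 : ℕ) : PowerSeries ℝ) * negLogOneSub ^ l) *
      one_sub_X_mul_derivative_negLogOneSub
  have h' := congrArg (PowerSeries.coeff n) h
  cases n with
  | zero =>
    rw [map_add, PowerSeries.coeff_zero_mul_X] at h'
    simp only [PowerSeries.coeff_derivative, PowerSeries.coeff_smul, smul_eq_mul] at h'
    push_cast at h' ⊢
    linarith
  | succ n =>
    rw [map_add, PowerSeries.coeff_succ_mul_X] at h'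
    simp only [PowerSeries.coeff_derivative, PowerSeries.coeff_smul, smul_eq_mul] at h'
    push_cast at h' ⊢
    linarith

lemma stirling1_succ_zero (n : ℕ) : stirling1 (n + 1) 0 = 0 := by
  simp [stirling1, Polynomial.coeff_zero_eq_eval_zero]

lemma stirling1_succ_succ (n l : ℕ) :
    stirling1 (n + 1) (l + 1) = n * stirling1 n (l + 1) + stirling1 n l := by
  simp only [stirling1]
  rw [ascPochhammer_succ_right, mul_add, Polynomial.coeff_add, Polynomial.coeff_mul_X,
    Polynomial.coeff_mul_natCast]
  simp only [Nat.cast_id]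
  ring

lemma coeff_negLogOneSub_pow (n l : ℕ) :
    PowerSeries.coeff n (negLogOneSub ^ l) = l.factorial * stirling1 n l / n.factorial := by
  induction n generalizing l with
  | zero =>
    cases l <;> simp [stirling1, negLogOneSub, Polynomial.coeff_one]
  | succ n ih =>
    cases l with
    | zero => simp [stirling1_succ_zero, PowerSeries.coeff_one]
    | succ l =>
      have h := coeff_negLogOneSub_pow_succ n l
      rw [ih, ih] at h
      have hn : (n : ℝ) + 1 ≠ 0 := by positivity
      have hf : (n.factorial : ℝ) ≠ 0 := by positivity
      apply mul_left_cancel₀ hn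
      rw [h, stirling1_succ_succ, Nat.factorial_succ n, Nat.factorial_succ l]
      push_cast
      field_simp

lemma logConv_eq_coeff (p : ℝ) (l n : ℕ) :
    logConv p l n =
      p ^ n / (-Real.log (1 - p)) ^ l * PowerSeries.coeff n (negLogOneSub ^ l) := by
  induction l generalizing n with
  | zero => by_cases hn : n = 0 <;> simp [logConv, PowerSeries.coeff_one, hn]
  | succ l ih =>
    rw [logConv, pow_succ' negLogOneSub, PowerSeries.coeff_mul,
      Finset.Nat.sum_antidiagonal_eq_sum_range_succ
        fun i j => PowerSeries.coeff i negLogOneSub * PowerSeries.coeff j (negLogOneSub ^ l),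
      Finset.mul_sum]
    refine Finset.sum_congr rfl fun u hu => ?_
    have hun : u ≤ n := Nat.lt_succ_iff.mp (Finset.mem_range.mp hu)
    rw [ih, logPMF]
    by_cases h0 : u = 0
    · simp [h0, negLogOneSub]
    · rw [if_neg h0, ← pow_mul_pow_sub p hun, negLogOneSub, PowerSeries.coeff_mk, pow_succ']
      simp only [div_eq_mul_inv, mul_inv]
      ring

/-- (Poisson-logarithmic bivariate PMF, compound Poisson side.)  For `r > 0`,
`p ∈ (0,1)`, and `n, l : ℕ`, the joint PMF of `l ∼ Pois(-r ln(1-p))` and `n = Σ_{t=1}^l u_t`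
with `u_t` i.i.d. `Log(p)` is
`Pois(-r ln(1-p))(l) ⋅ Log(p)^{*l}(n) = |s(n,l)| r^l p^n (1-p)^r / n!`. -/
theorem poisson_log_joint (r p : ℝ) (hr : 0 < r) (hp0 : 0 < p) (hp1 : p < 1) (n l : ℕ) :
    poisPMF (-r * Real.log (1 - p)) l * logConv p l n
      = (stirling1 n l : ℝ) * r ^ l * p ^ n * (1 - p) ^ r / n.factorial := by
  have hlog : Real.log (1 - p) < 0 := Real.log_neg (by linarith) (by linarith)
  have hexp : Real.exp (-(-r * Real.log (1 - p))) = (1 - p) ^ r := by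
    rw [Real.rpow_def_of_pos (by linarith)]
    ring_nf
  have hL : (-Real.log (1 - p)) ^ l ≠ 0 := pow_ne_zero _ (by linarith)
  rw [poisPMF, hexp, logConv_eq_coeff, coeff_negLogOneSub_pow,
    show -r * Real.log (1 - p) = r * -Real.log (1 - p) by ring, mul_pow]
  field_simp
end

section
/- (CRT conditional in Corollary 1.) For every r > 0, p ∈ (0,1), n ∈ ℕ, and l ∈ ℕ, in the compound Poisson model where l ∼ Pois(−r ln(1−p)) and n is the sum of l i.i.d. Log(p) variables, the conditional distribution of l given n is CRT(n,r): Pois(−r ln(1−p))(l) · Log(p)^{*l}(n) / NB(r,p)(n) = CRT(n,r)(l), where NB(r,p)(n) > 0 is the marginal probability of n. -/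
open MeasureTheory

open PowerSeries in
theorem logConv_eq_coeff_s9 (p : ℝ) (l n : ℕ) :
    logConv p l n = coeff n (PowerSeries.mk (logPMF p) ^ l) := by
  induction l generalizing n with
  | zero => simp [logConv, coeff_one]
  | succ l ih =>
    rw [pow_succ', coeff_mul, Finset.Nat.sum_antidiagonal_eq_sum_range_succ_mk]
    simp [logConv, ih]

open PowerSeries in
theorem logSeries_derivative (p : ℝ) :
    (1 - C p * X) * derivative ℝ (PowerSeries.mk (logPMF p)) = C (p / -Real.log (1 - p)) := by
  have coeff_deriv (n : ℕ) : coeff n (derivative ℝ (PowerSeries.mk (logPMF p))) =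
      p ^ (n + 1) / -Real.log (1 - p) := by
    have hn : (n : ℝ) + 1 ≠ 0 := by positivity
    simp only [coeff_derivative, coeff_mk, logPMF, Nat.add_eq_zero_iff,
      one_ne_zero, and_false, if_false, Nat.cast_add, Nat.cast_one]
    rw [← div_div, div_mul_cancel₀ _ hn]
  ext n
  rw [sub_mul, one_mul, map_sub, mul_assoc, coeff_C_mul, coeff_C]
  cases n with
  | zero => simp [coeff_deriv]
  | succ n =>
    rw [coeff_succ_X_mul, coeff_deriv, coeff_deriv, if_neg n.succ_ne_zero]
    ring

open PowerSeries in
/-- Coefficientwise form of `(1 - p X) (L ^ (l + 1))' = (l + 1) (p / -log (1 - p)) L ^ l`,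
where `L` is the generating series of `Log(p)`. -/
theorem logConv_succ_succ (p : ℝ) (l n : ℕ) :
    (n + 1) * logConv p (l + 1) (n + 1) =
      p * n * logConv p (l + 1) n + (l + 1) * (p / -Real.log (1 - p)) * logConv p l n := by
  simp only [logConv_eq_coeff_s9]
  set L := PowerSeries.mk (logPMF p)
  have hD : (1 - C p * X) * derivative ℝ (L ^ (l + 1)) =
      C ((l + 1) * (p / -Real.log (1 - p))) * L ^ l := by
    rw [Derivation.leibniz_pow, map_mul, ← logSeries_derivative]
    simp only [add_tsub_cancel_right, nsmul_eq_mul, smul_eq_mul, map_add, map_one, map_natCast,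
      Nat.cast_add, Nat.cast_one]
    ring
  have h := congrArg (coeff n) hD
  rw [sub_mul, one_mul, map_sub, mul_assoc, coeff_C_mul, coeff_C_mul] at h
  cases n with
  | zero =>
    simp only [coeff_derivative, coeff_zero_X_mul] at h
    linear_combination h
  | succ n =>
    simp only [coeff_derivative, coeff_succ_X_mul] at h
    push_cast at h ⊢
    linear_combination h

theorem nbPMF_pos {r p : ℝ} (hr : 0 < r) (hp0 : 0 < p) (hp1 : p < 1) (n : ℕ) :
    0 < nbPMF r p n := by
  have h1 : 0 < Real.Gamma (n + r) := Real.Gamma_pos_of_pos (by positivity)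
  have h2 : 0 < Real.Gamma r := Real.Gamma_pos_of_pos hr
  have h3 : 0 < (1 - p) ^ r := Real.rpow_pos_of_pos (sub_pos.2 hp1) r
  unfold nbPMF
  positivity

theorem nbPMF_succ {r : ℝ} (hr : 0 < r) (p : ℝ) (n : ℕ) :
    (n + 1) * nbPMF r p (n + 1) = (n + r) * p * nbPMF r p n := by
  have h1 : Real.Gamma r ≠ 0 := (Real.Gamma_pos_of_pos hr).ne'
  have h2 : Real.Gamma ((n + 1 : ℕ) + r) = (n + r) * Real.Gamma (n + r) := by
    rw [← Real.Gamma_add_one (by positivity)]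
    push_cast
    ring_nf
  simp only [nbPMF, h2, Nat.factorial_succ]
  push_cast
  field_simp
  ring

theorem poisPMF_succ (lam : ℝ) (l : ℕ) :
    (l + 1) * poisPMF lam (l + 1) = lam * poisPMF lam l := by
  simp only [poisPMF, Nat.factorial_succ]
  push_cast
  field_simp
  ring

theorem nbPMF_zero {r p : ℝ} (hr : 0 < r) (hp1 : p < 1) :
    nbPMF r p 0 = poisPMF (-r * Real.log (1 - p)) 0 := by
  have h1 : Real.Gamma r ≠ 0 := (Real.Gamma_pos_of_pos hr).ne'
  simp [nbPMF, poisPMF, h1, Real.rpow_def_of_pos (sub_pos.2 hp1), mul_comm]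

theorem logConv_succ_zero (p : ℝ) (l : ℕ) : logConv p (l + 1) 0 = 0 := by
  simp [logConv, logPMF]

theorem poisPMF_mul_logConv {r p : ℝ} (hr : 0 < r) (hp0 : 0 < p) (hp1 : p < 1) (n l : ℕ) :
    poisPMF (-r * Real.log (1 - p)) l * logConv p l n = crtPMF r n l * nbPMF r p n := by
  induction n generalizing l with
  | zero =>
    cases l with
    | zero => simp [logConv, crtPMF, nbPMF_zero hr hp1]
    | succ l => simp [logConv_succ_zero, crtPMF]
  | succ n ih =>
    have hn : (n : ℝ) + 1 ≠ 0 := by positivity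
    have hrn : r + n ≠ 0 := by positivity
    have hlog : Real.log (1 - p) ≠ 0 :=
      (Real.log_neg (sub_pos.2 hp1) (by linarith)).ne
    have hnb := nbPMF_succ hr p n
    have hcrt : (r + n) * crtPMF r (n + 1) l =
        r * (if l = 0 then 0 else crtPMF r n (l - 1)) + n * crtPMF r n l := by
      simp only [crtPMF]
      field_simp
      ring
    apply mul_left_cancel₀ hn
    cases l with
    | zero =>
      have h0 : (n : ℝ) * logConv p 0 n = 0 := by
        cases n <;> simp [logConv]
      have h1 : logConv p 0 (n + 1) = 0 := by simp [logConv]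
      have := ih 0
      rw [if_pos rfl] at hcrt
      rw [h1]
      linear_combination (-crtPMF r (n + 1) 0) * hnb - p * nbPMF r p n * hcrt
        + n * p * this - p * poisPMF (-r * Real.log (1 - p)) 0 * h0
    | succ l =>
      have hconv := logConv_succ_succ p l n
      have hpois := poisPMF_succ (-r * Real.log (1 - p)) l
      have hq : p / -Real.log (1 - p) * (-r * Real.log (1 - p)) = r * p := by
        field_simp
      have ih0 := ih l
      have ih1 := ih (l + 1)
      rw [if_neg l.succ_ne_zero, Nat.add_sub_cancel] at hcrt
      linear_combination poisPMF (-r * Real.log (1 - p)) (l + 1) * hconv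
        + p / -Real.log (1 - p) * logConv p l n * hpois
        + poisPMF (-r * Real.log (1 - p)) l * logConv p l n * hq
        + r * p * ih0 + n * p * ih1
        - crtPMF r (n + 1) (l + 1) * hnb - p * nbPMF r p n * hcrt

/-- (CRT conditional.)  For `r > 0`, `p ∈ (0,1)`, and `n, l : ℕ`, in the
compound Poisson model where `l ∼ Pois(-r ln(1-p))` and `n` is the sum of `l` i.i.d. `Log(p)`
variables, the marginal probability `NB(r,p)(n)` of `n` is positive and the conditional
distribution of `l` given `n` is `CRT(n,r)`:
`Pois(-r ln(1-p))(l) ⋅ Log(p)^{*l}(n) / NB(r,p)(n) = CRT(n,r)(l)`. -/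
theorem crt_conditional (r p : ℝ) (hr : 0 < r) (hp0 : 0 < p) (hp1 : p < 1) (n l : ℕ) :
    0 < nbPMF r p n ∧
    poisPMF (-r * Real.log (1 - p)) l * logConv p l n / nbPMF r p n = crtPMF r n l := by
  have hpos := nbPMF_pos hr hp0 hp1 n
  exact ⟨hpos, by rw [div_eq_iff hpos.ne', poisPMF_mul_logConv hr hp0 hp1]⟩
end
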